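/- (Truncated self-energy as an exact self-energy) Fix a symmetric positive definite n×n matrix G and an interaction U such that εU has superquadratic growth for all ε > 0. Let Σ(ε) = Σ[G; εU] and let Σ̄^(N)(ε) = Σ_{k=1}^N Σ^(k)[G;U] εᵏ be the N-th partial sum of its asymptotic series. Then for each ε > 0 and N, defining the modified interaction U_ε^(N)(x) = εU(x) + ½ xᵀ(Σ(ε) - Σ̄^(N)(ε))x, one has Σ̄^(N)(ε) = Σ[G; U_ε^(N)], i.e., Σ̄^(N)(ε) is the exact self-energy at G induced by the interaction U_ε^(N). -/

import Mathlib

open MeasureTheory Matrix Filter Topology Real Asymptotics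

attribute [local instance] Matrix.normedAddCommGroup Matrix.normedSpace

noncomputable section

/-- The partition function `Z[A] = ∫ exp(-½ xᵀAx - U(x)) dx`. -/
def Zfun (n : ℕ) (U : (Fin n → ℝ) → ℝ) (A : Matrix (Fin n) (Fin n) ℝ) : ℝ :=
  ∫ x : Fin n → ℝ, Real.exp (-(1 / 2) * (x ⬝ᵥ A.mulVec x) - U x)

/-- The free energy `Ω[A] = -log Z[A]`. -/
def Omega (n : ℕ) (U : (Fin n → ℝ) → ℝ) (A : Matrix (Fin n) (Fin n) ℝ) : ℝ :=
  - Real.log (Zfun n U A)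

/-- `U` is continuous with superquadratic growth: for every `c > 0`,
`U x - c * |x|² → +∞` as `|x| → ∞`. -/
def SuperQuadratic {n : ℕ} (U : (Fin n → ℝ) → ℝ) : Prop :=
  Continuous U ∧ ∀ c : ℝ, 0 < c →
    Tendsto (fun x : Fin n → ℝ => U x - c * ‖x‖ ^ 2) (cocompact _) atTop

/-- A probability density on `ℝⁿ` with finite second moments and finite
differential entropy. -/
def IsGoodDensity {n : ℕ} (ρ : (Fin n → ℝ) → ℝ) : Prop :=
  Measurable ρ ∧ (∀ x, 0 ≤ ρ x) ∧ (∫ x, ρ x) = 1 ∧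
  (∀ i j : Fin n, Integrable fun x => x i * x j * ρ x) ∧
  Integrable fun x => ρ x * Real.log (ρ x)

/-- Differential entropy `S(ρ) = -∫ ρ log ρ`. -/
def entropy {n : ℕ} (ρ : (Fin n → ℝ) → ℝ) : ℝ := - ∫ x, ρ x * Real.log (ρ x)

/-- Second-moment matrix `𝒢(ρ) = ∫ x xᵀ ρ(x) dx`. -/
def momMatrix {n : ℕ} (ρ : (Fin n → ℝ) → ℝ) : Matrix (Fin n) (Fin n) ℝ :=
  Matrix.of fun i j => ∫ x, x i * x j * ρ x

/-- `𝓕[G;U] = sup { S(ρ) - ∫ U ρ : ρ ∈ 𝓜, 𝒢(ρ) = G }`. -/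
def Ffun (n : ℕ) (U : (Fin n → ℝ) → ℝ) (G : Matrix (Fin n) (Fin n) ℝ) : ℝ :=
  sSup { r : ℝ | ∃ ρ : (Fin n → ℝ) → ℝ, IsGoodDensity ρ ∧
    (Integrable fun x => U x * ρ x) ∧ momMatrix ρ = G ∧
    r = entropy ρ - ∫ x, U x * ρ x }

/-- The Luttinger-Ward functional `Φ[G;U] = 2𝓕[G;U] - Tr[log G] - n log(2πe)`.
(For positive definite `G`, `Tr[log G] = log det G`.) -/
def Phi (n : ℕ) (U : (Fin n → ℝ) → ℝ) (G : Matrix (Fin n) (Fin n) ℝ) : ℝ :=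
  2 * Ffun n U G - Real.log G.det - (n : ℝ) * Real.log (2 * π * Real.exp 1)

/-- The continuous linear functional `H ↦ Tr[S * H]` on matrices. -/
def tracePairing {n : ℕ} (S : Matrix (Fin n) (Fin n) ℝ) :
    Matrix (Fin n) (Fin n) ℝ →L[ℝ] ℝ :=
  LinearMap.toContinuousLinearMap
    { toFun := fun H => (S * H).trace
      map_add' := fun H K => by simp [Matrix.mul_add]
      map_smul' := fun c H => by simp [Matrix.mul_smul] }


section
open scoped MatrixOrder
lemma posSemidef_factor {n : ℕ} (M : Matrix (Fin n) (Fin n) ℝ) (hM : M.PosSemidef) :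
    ∃ C : Matrix (Fin n) (Fin n) ℝ, M = Cᵀ * C := by
  obtain ⟨C, hC⟩ := CStarAlgebra.nonneg_iff_eq_star_mul_self.1 hM.nonneg
  exact ⟨C, by rw [hC, Matrix.star_eq_conjTranspose, Matrix.conjTranspose_eq_transpose_of_trivial]⟩
end

lemma momQ (n : ℕ) (r : ℝ) (i j : Fin n) (hr : 0 < r) :
    ∫ y in (Set.univ.pi fun _ : Fin n => Set.Icc (-r) r), y i * y j
      = if i = j then (2 * r) ^ n * (r ^ 2 / 3) else 0 := by
  have h1 : ∀ y : Fin n → ℝ, y i * y j =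
      ∏ k, (fun (k : Fin n) (t : ℝ) => (if k = i then t else 1) * (if k = j then t else 1)) k (y k) := by
    intro y
    beta_reduce
    rw [Finset.prod_mul_distrib, Finset.prod_ite_eq', Finset.prod_ite_eq']
    simp
  rw [funext h1, volume_pi, Measure.restrict_pi_pi]
  refine (integral_fintype_prod_eq_prod (𝕜 := ℝ) (E := fun _ : Fin n => ℝ)
    (μ := fun _ => volume.restrict (Set.Icc (-r) r))
    (fun (k : Fin n) (t : ℝ) => (if k = i then t else 1) * (if k = j then t else 1))).trans ?_
  have i0 : ∫ t in Set.Icc (-r) r, (1:ℝ) = 2 * r := by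
    rw [integral_Icc_eq_integral_Ioc, ← intervalIntegral.integral_of_le (by linarith)]
    simp; ring
  have i1 : ∫ t in Set.Icc (-r) r, (t:ℝ) = 0 := by
    rw [integral_Icc_eq_integral_Ioc, ← intervalIntegral.integral_of_le (by linarith)]
    simp
  have i2 : ∫ t in Set.Icc (-r) r, (t * t:ℝ) = (2 * r) * (r ^ 2 / 3) := by
    rw [integral_Icc_eq_integral_Ioc, ← intervalIntegral.integral_of_le (by linarith)]
    simp_rw [← pow_two]
    rw [integral_pow]; push_cast; ring
  split_ifs with hij
  · subst hij
    rw [← Finset.mul_prod_erase Finset.univ _ (Finset.mem_univ i)]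
    have : ∀ k ∈ Finset.univ.erase i, ∫ t in Set.Icc (-r) r,
        ((if k = i then t else 1) * (if k = i then t else 1)) = 2 * r := by
      intro k hk
      simp only [Finset.mem_erase] at hk
      simp only [hk.1, if_false, mul_one]
      exact i0
    rw [Finset.prod_congr rfl this]
    simp only [if_true, i2, Finset.prod_const, Finset.card_erase_of_mem (Finset.mem_univ i),
      Finset.card_univ, Fintype.card_fin]
    have hn : n = (n - 1) + 1 := by have := i.pos; omega
    conv_rhs => rw [hn, pow_succ]
    ring
  · apply Finset.prod_eq_zero (Finset.mem_univ i)
    simp only [if_true, hij, if_false, mul_one]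
    exact i1

lemma volQ (n : ℕ) (r : ℝ) (hr : 0 < r) :
    ∫ _ in (Set.univ.pi fun _ : Fin n => Set.Icc (-r) r), (1:ℝ) = (2 * r) ^ n := by
  simp only [integral_const, smul_eq_mul, mul_one, measureReal_restrict_apply_univ]
  rw [measureReal_def, volume_pi, Measure.pi_pi]
  simp [ENNReal.toReal_prod, ENNReal.toReal_ofReal, hr.le]
  congr 1; ring

lemma moments_integral {n : ℕ} (ρ : (Fin n → ℝ) → ℝ) (h : IsGoodDensity ρ)
    (D : Matrix (Fin n) (Fin n) ℝ) :
    Integrable (fun x => (x ⬝ᵥ D.mulVec x) * ρ x) ∧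
      ∫ x, (x ⬝ᵥ D.mulVec x) * ρ x = (D * momMatrix ρ).trace := by
  have e : ∀ x : Fin n → ℝ, (x ⬝ᵥ D.mulVec x) * ρ x = ∑ i, ∑ j, D i j * (x j * x i * ρ x) := by
    intro x
    simp only [dotProduct, mulVec, Finset.sum_mul, Finset.mul_sum]
    refine Finset.sum_congr rfl fun i _ => Finset.sum_congr rfl fun j _ => ?_
    ring
  have hi := h.2.2.2.1
  simp_rw [e]
  constructor
  · exact integrable_finsetSum _ fun i _ => integrable_finsetSum _ fun j _ => (hi j i).const_mul _
  · rw [integral_finsetSum Finset.univ (f := fun i (x : Fin n → ℝ) => ∑ j, D i j * (x j * x i * ρ x))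
      fun i _ => integrable_finsetSum _ fun j _ => (hi j i).const_mul _]
    simp only [Matrix.trace, Matrix.diag, Matrix.mul_apply, momMatrix, Matrix.of_apply]
    refine Finset.sum_congr rfl fun i _ => ?_
    rw [integral_finsetSum _ fun j _ => (hi j i).const_mul _]
    refine Finset.sum_congr rfl fun j _ => ?_
    rw [integral_const_mul]

def Fset (n : ℕ) (V : (Fin n → ℝ) → ℝ) (M : Matrix (Fin n) (Fin n) ℝ) : Set ℝ :=
  { r : ℝ | ∃ ρ : (Fin n → ℝ) → ℝ, IsGoodDensity ρ ∧
    (Integrable fun x => V x * ρ x) ∧ momMatrix ρ = M ∧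
    r = entropy ρ - ∫ x, V x * ρ x }

lemma good_integrable {n : ℕ} {ρ : (Fin n → ℝ) → ℝ} (h : IsGoodDensity ρ) : Integrable ρ := by
  by_contra hc
  have := h.2.2.1
  rw [integral_undef hc] at this
  exact zero_ne_one this

lemma gauss_int (n : ℕ) : Integrable (fun x : Fin n → ℝ => Real.exp (-(x ⬝ᵥ x))) := by
  have : (fun x : Fin n → ℝ => Real.exp (-(x ⬝ᵥ x)))
      = fun x => ∏ i, (fun (_ : Fin n) (t : ℝ) => Real.exp (-1 * t ^ 2)) i (x i) := by
    ext x
    rw [← Real.exp_sum]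
    congr 1
    simp [dotProduct, pow_two]
  rw [this, volume_pi]
  exact Integrable.fintype_prod fun i => integrable_exp_neg_mul_sq one_pos

lemma Fset_bdd (n : ℕ) (V : (Fin n → ℝ) → ℝ) (m : ℝ) (hm : ∀ x, m ≤ V x)
    (M : Matrix (Fin n) (Fin n) ℝ) : BddAbove (Fset n V M) := by
  refine ⟨M.trace + (∫ x : Fin n → ℝ, Real.exp (-(x ⬝ᵥ x))) - 1 - m, ?_⟩
  rintro _ ⟨ρ, h, hV, hM, rfl⟩
  have hρ := good_integrable h
  have h1 : m ≤ ∫ x, V x * ρ x := by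
    calc m = ∫ x, m * ρ x := by rw [integral_const_mul, h.2.2.1, mul_one]
      _ ≤ _ := integral_mono (hρ.const_mul m) hV
        fun x => mul_le_mul_of_nonneg_right (hm x) (h.2.1 x)
  obtain ⟨q1, q2⟩ := moments_integral ρ h 1
  simp only [Matrix.one_mulVec, one_mul, hM] at q1 q2
  have h2 : entropy ρ ≤ M.trace + (∫ x : Fin n → ℝ, Real.exp (-(x ⬝ᵥ x))) - 1 := by
    rw [entropy, ← integral_neg, ← q2, ← h.2.2.1, ← integral_add q1 (gauss_int n),
      ← integral_sub (f := fun x : Fin n → ℝ => x ⬝ᵥ x * ρ x + Real.exp (-(x ⬝ᵥ x)))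
        (q1.add (gauss_int n)) hρ]
    refine integral_mono h.2.2.2.2.neg ((q1.add (gauss_int n)).sub hρ) fun x => ?_
    simp only [Pi.add_apply, Pi.sub_apply, Pi.neg_apply]
    rcases (h.2.1 x).eq_or_lt with h0 | h0
    · rw [← h0]; simp; positivity
    · have := Real.log_le_sub_one_of_pos (div_pos (Real.exp_pos (-(x ⬝ᵥ x))) h0)
      rw [Real.log_div (Real.exp_pos _).ne' h0.ne', Real.log_exp] at this
      have h3 := mul_le_mul_of_nonneg_left this h0.le
      have h4 : ρ x * (Real.exp (-(x ⬝ᵥ x)) / ρ x - 1) = Real.exp (-(x ⬝ᵥ x)) - ρ x := by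
        field_simp
      rw [h4] at h3
      linarith
  linarith

lemma Fset_shift (n : ℕ) (V : (Fin n → ℝ) → ℝ) (M D : Matrix (Fin n) (Fin n) ℝ) (r : ℝ)
    (hr : r ∈ Fset n V M) :
    r - (1 / 2) * (D * M).trace ∈ Fset n (fun x => V x + (1 / 2) * (x ⬝ᵥ D.mulVec x)) M := by
  obtain ⟨ρ, h, hV, hM, rfl⟩ := hr
  obtain ⟨q1, q2⟩ := moments_integral ρ h D
  have e : (fun x => (V x + (1 / 2) * (x ⬝ᵥ D.mulVec x)) * ρ x) =
      fun x => V x * ρ x + (1 / 2) * ((x ⬝ᵥ D.mulVec x) * ρ x) := by ext x; ring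
  refine ⟨ρ, h, ?_, hM, ?_⟩
  · simp only [e]; exact hV.add (q1.const_mul _)
  · simp only [e]
    rw [integral_add hV (q1.const_mul _), integral_const_mul, q2, hM]; ring

lemma Ffun_shift (n : ℕ) (V : (Fin n → ℝ) → ℝ) (M D : Matrix (Fin n) (Fin n) ℝ)
    (hne : (Fset n V M).Nonempty) (hb : BddAbove (Fset n V M)) :
    Ffun n (fun x => V x + (1 / 2) * (x ⬝ᵥ D.mulVec x)) M
      = Ffun n V M - (1 / 2) * (D * M).trace := by
  change sSup (Fset n _ M) = sSup (Fset n V M) - _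
  refine IsLUB.csSup_eq ?_ ?_
  · have hl := isLUB_csSup hne hb
    constructor
    · intro r hr
      have := Fset_shift n _ M (-D) r hr
      have e : (fun x => V x + (1 / 2) * (x ⬝ᵥ D.mulVec x) + (1 / 2) * (x ⬝ᵥ (-D).mulVec x)) = V := by
        ext x; simp [Matrix.neg_mulVec]
      rw [e] at this
      have := hl.1 this
      simp only [Matrix.neg_mul, Matrix.trace_neg] at this
      linarith
    · intro b hb'
      have : sSup (Fset n V M) ≤ b + (1 / 2) * (D * M).trace := by
        refine hl.2 fun r hr => ?_
        have := hb' (Fset_shift n V M D r hr)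
        linarith
      linarith
  · obtain ⟨r, hr⟩ := hne
    exact ⟨_, Fset_shift n V M D r hr⟩

lemma posDef_nhds {n : ℕ} (G : Matrix (Fin n) (Fin n) ℝ) (hG : G.PosDef) :
    ∀ᶠ M in 𝓝[{M : Matrix (Fin n) (Fin n) ℝ | M.IsSymm}] G, M.PosDef := by
  have hc : Continuous fun z : Matrix (Fin n) (Fin n) ℝ × (Fin n → ℝ) => z.2 ⬝ᵥ z.1.mulVec z.2 := by
    fun_prop
  have key : ∀ᶠ M in 𝓝 G, ∀ y ∈ Metric.sphere (0 : Fin n → ℝ) 1, 0 < y ⬝ᵥ M.mulVec y := by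
    refine (isCompact_sphere _ _).eventually_forall_of_forall_eventually fun y hy => ?_
    have hy0 : y ≠ 0 := by
      rintro rfl
      simp at hy
    have := hG.dotProduct_mulVec_pos hy0
    simp only [star_trivial] at this
    exact hc.continuousAt.eventually (lt_mem_nhds this)
  filter_upwards [mem_nhdsWithin_of_mem_nhds key, self_mem_nhdsWithin] with M h1 h2
  refine .of_dotProduct_mulVec_pos ?_ fun x hx => ?_
  · rw [Matrix.IsHermitian, Matrix.conjTranspose_eq_transpose_of_trivial]; exact h2
  · simp only [star_trivial]
    have hx' : 0 < ‖x‖ := norm_pos_iff.mpr hx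
    have := h1 (‖x‖⁻¹ • x) (by simp [norm_smul, hx'.ne'])
    rw [Matrix.mulVec_smul, dotProduct_smul, smul_dotProduct, smul_eq_mul, smul_eq_mul] at this
    have h3 : 0 < ‖x‖⁻¹ := inv_pos.mpr hx'
    exact (mul_pos_iff_of_pos_left h3).1 ((mul_pos_iff_of_pos_left h3).1 this)

lemma Fset_nonempty (n : ℕ) (V : (Fin n → ℝ) → ℝ) (hV : Continuous V)
    (M : Matrix (Fin n) (Fin n) ℝ) (hM : M.PosDef) : (Fset n V M).Nonempty := by
  obtain ⟨B, hBu, hB⟩ : ∃ B : Matrix (Fin n) (Fin n) ℝ, B.det ≠ 0 ∧ M = B * Bᵀ := by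
    obtain ⟨C, hC⟩ := posSemidef_factor M hM.posSemidef
    refine ⟨Cᵀ, ?_, by rw [hC, Matrix.transpose_transpose]⟩
    intro h0
    have := hM.det_pos
    rw [hC, Matrix.det_mul, h0, zero_mul] at this
    exact lt_irrefl _ this
  set r : ℝ := √3 with hr
  have hr0 : 0 < r := by positivity
  have hr2 : r ^ 2 = 3 := Real.sq_sqrt (by norm_num)
  set Q : Set (Fin n → ℝ) := Set.univ.pi fun _ : Fin n => Set.Icc (-r) r with hQ
  have hQc : IsCompact Q := isCompact_univ_pi fun _ => isCompact_Icc
  let L : (Fin n → ℝ) →L[ℝ] (Fin n → ℝ) := LinearMap.toContinuousLinearMap (Matrix.toLin' B)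
  have hLx : ∀ x, L x = B.mulVec x := fun x => rfl
  have hLdet : L.det = B.det := by
    simp [L, ContinuousLinearMap.det]
  have hLinj : Function.Injective L := by
    intro x y hxy
    exact Matrix.mulVec_injective_of_isUnit
      ((Matrix.isUnit_iff_isUnit_det _).2 (isUnit_iff_ne_zero.2 hBu)) hxy
  set K : Set (Fin n → ℝ) := L '' Q with hK
  have hKc : IsCompact K := hQc.image L.continuous
  have hKm : MeasurableSet K := hKc.measurableSet
  have hint : ∀ g : (Fin n → ℝ) → ℝ, ∫ x in K, g x = |B.det| * ∫ y in Q, g (B.mulVec y) := by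
    intro g
    rw [hK, integral_image_eq_integral_abs_det_fderiv_smul volume hQc.measurableSet
      (fun x _ => L.hasFDerivWithinAt) hLinj.injOn g, hLdet]
    simp only [smul_eq_mul, hLx]
    rw [integral_const_mul]
  set a : ℝ := (|B.det| * (2 * r) ^ n)⁻¹ with ha
  have ha0 : 0 < a := by have := abs_pos.2 hBu; positivity
  have hgi : ∀ g : (Fin n → ℝ) → ℝ, (fun x => g x * K.indicator (fun _ => a) x)
      = K.indicator (fun x => g x * a) := by
    intro g; ext x; by_cases hx : x ∈ K <;> simp [hx]
  have hgint : ∀ g : (Fin n → ℝ) → ℝ, Continuous g →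
      Integrable (fun x => g x * K.indicator (fun _ => a) x) := by
    intro g hg
    rw [hgi, integrable_indicator_iff hKm]
    exact (hg.mul continuous_const).continuousOn.integrableOn_compact hKc
  have hgval : ∀ g : (Fin n → ℝ) → ℝ, ∫ x, g x * K.indicator (fun _ => a) x
      = ((2 * r) ^ n)⁻¹ * ∫ y in Q, g (B.mulVec y) := by
    intro g
    rw [hgi, integral_indicator hKm, integral_mul_const, hint, ha]
    have := abs_pos.2 hBu
    field_simp
  refine ⟨_, K.indicator (fun _ => a), ⟨?_, ?_, ?_, ?_, ?_⟩, hgint V hV, ?_, rfl⟩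
  · exact measurable_const.indicator hKm
  · intro x; exact Set.indicator_nonneg (fun _ _ => ha0.le) x
  · have := hgval (fun _ => 1)
    simp only [one_mul] at this
    rw [this, volQ n r hr0]
    field_simp
  · intro i j
    exact hgint (fun x => x i * x j) (by fun_prop)
  · have : (fun x => K.indicator (fun _ => a) x * Real.log (K.indicator (fun _ => a) x)) =
        fun x => (fun _ => Real.log a) x * K.indicator (fun _ => a) x := by
      ext x; by_cases hx : x ∈ K <;> simp [hx, mul_comm]
    rw [this]
    exact hgint (fun _ => Real.log a) continuous_const
  · ext i j
    simp only [momMatrix, Matrix.of_apply]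
    rw [hgval (fun x => x i * x j)]
    have e : ∀ y : Fin n → ℝ, B.mulVec y i * B.mulVec y j =
        ∑ k, ∑ l, (B i k * B j l) * (y k * y l) := by
      intro y
      simp only [Matrix.mulVec, dotProduct, Finset.sum_mul_sum]
      refine Finset.sum_congr rfl fun k _ => Finset.sum_congr rfl fun l _ => ?_
      ring
    have hi : ∀ k l, Integrable (fun y : Fin n → ℝ => (B i k * B j l) * (y k * y l))
        (volume.restrict Q) := fun k l =>
      (show Continuous fun y : Fin n → ℝ => (B i k * B j l) * (y k * y l) by
        fun_prop).continuousOn.integrableOn_compact hQc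
    simp_rw [e]
    rw [integral_finsetSum _ fun k _ => integrable_finsetSum _ fun l _ => hi k l]
    simp_rw [integral_finsetSum _ fun l _ => hi _ l, integral_const_mul, hQ, momQ n r _ _ hr0]
    rw [hr2, hB, Matrix.mul_apply, Finset.mul_sum]
    refine Finset.sum_congr rfl fun k _ => ?_
    simp only [mul_ite, mul_zero, Finset.sum_ite_eq, Finset.mem_univ, if_true,
      Matrix.transpose_apply]
    field_simp

/-- Truncated self-energy as an exact self-energy: fix `G ≻ 0` and `U`
such that `εU` has superquadratic growth for all `ε > 0`. Let `Sig ε = Σ[G; εU]` be the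
self-energy at `G` and let `Σ̄^(N)(ε) = Σ_{k=1}^N ε^k Σ^(k)` be the `N`-th partial sum of
its asymptotic series. Then for each `ε > 0` and `N`, with modified interaction
`U_ε^(N)(x) = εU(x) + ½ xᵀ(Σ(ε) - Σ̄^(N)(ε))x`, the matrix `Σ̄^(N)(ε)` is the exact
self-energy at `G` induced by `U_ε^(N)`, i.e. the gradient of `Φ[·; U_ε^(N)]` at `G`
along symmetric matrices. -/
theorem statement15 (n : ℕ) (hn : 1 ≤ n) (U : (Fin n → ℝ) → ℝ)
    (hU : Continuous U)
    (hU' : ∀ ε : ℝ, 0 < ε → SuperQuadratic (fun x => ε * U x))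
    (G : Matrix (Fin n) (Fin n) ℝ) (hG : G.PosDef)
    (Sig : ℝ → Matrix (Fin n) (Fin n) ℝ)
    (hSig : ∀ ε : ℝ, 0 < ε → (Sig ε).IsSymm ∧
      HasFDerivWithinAt (Phi n (fun x => ε * U x)) (tracePairing (Sig ε))
        {M : Matrix (Fin n) (Fin n) ℝ | M.IsSymm} G)
    (S : ℕ → Matrix (Fin n) (Fin n) ℝ)
    (hSsymm : ∀ k, (S k).IsSymm)
    (hSigAsymp : ∀ N : ℕ,
      (fun ε : ℝ => Sig ε - ∑ k ∈ Finset.Icc 1 N, ε ^ k • S k)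
        =O[𝓝[>] (0 : ℝ)] fun ε => ε ^ (N + 1)) :
    ∀ ε : ℝ, 0 < ε → ∀ N : ℕ,
      HasFDerivWithinAt
        (Phi n (fun x => ε * U x + (1 / 2) *
          (x ⬝ᵥ (Sig ε - ∑ k ∈ Finset.Icc 1 N, ε ^ k • S k).mulVec x)))
        (tracePairing (∑ k ∈ Finset.Icc 1 N, ε ^ k • S k))
        {M : Matrix (Fin n) (Fin n) ℝ | M.IsSymm} G := by
  intro ε hε N
  set T := ∑ k ∈ Finset.Icc 1 N, ε ^ k • S k with hT
  obtain ⟨hs, hd⟩ := hSig ε hε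
  obtain ⟨hc, ht⟩ := hU' ε hε
  obtain ⟨x₀, hx₀⟩ := (hc.sub (by fun_prop : Continuous fun x : Fin n → ℝ => 1 * ‖x‖ ^ 2)).exists_forall_le
    (ht 1 one_pos)
  have hb : ∀ x, ε * U x₀ - 1 * ‖x₀‖ ^ 2 ≤ ε * U x := fun x => by
    have := hx₀ x
    simp only [Pi.sub_apply] at this
    nlinarith [sq_nonneg ‖x‖]
  have hphi : ∀ M : Matrix (Fin n) (Fin n) ℝ, M.PosDef →
      Phi n (fun x => ε * U x + (1 / 2) * (x ⬝ᵥ (Sig ε - T).mulVec x)) M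
        = Phi n (fun x => ε * U x) M - tracePairing (Sig ε - T) M := by
    intro M hM
    have := Ffun_shift n (fun x => ε * U x) M (Sig ε - T) (Fset_nonempty n _ hc M hM)
      (Fset_bdd n _ _ hb M)
    have e : tracePairing (Sig ε - T) M = ((Sig ε - T) * M).trace := rfl
    simp only [Phi]
    rw [this, e]; ring
  have hlin : tracePairing T = tracePairing (Sig ε) - tracePairing (Sig ε - T) := by
    ext M
    change (T * M).trace = (Sig ε * M).trace - ((Sig ε - T) * M).trace
    rw [Matrix.sub_mul, Matrix.trace_sub]; ring
  rw [hlin]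
  refine (hd.sub (tracePairing (Sig ε - T)).hasFDerivWithinAt).congr_of_eventuallyEq ?_ (hphi G hG)
  filter_upwards [posDef_nhds G hG] with M hM
  exact hphi M hM
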